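/- The Gauss hypergeometric series satisfies ₂F₁(3/5, 4/5; 9/10; 3/128) = (8/75) · √2 · 3^{1/10} · √5 · √(5+√5). -/

import Mathlib

open scoped Nat

/-- Pochhammer symbol (rising factorial) on the reals. -/
noncomputable def poch (a : ℝ) (n : ℕ) : ℝ := ∏ i ∈ Finset.range n, (a + i)

/-- Gauss hypergeometric series ₂F₁(a,b;c;x) as a real series. -/
noncomputable def twoFone (a b c x : ℝ) : ℝ :=
  ∑' n : ℕ, poch a n * poch b n / (poch c n * (n ! : ℝ)) * x ^ n

open MeasureTheory Set

lemma beta_aux {α β : ℝ} (hα : 0 < α) (hβ : 0 < β) :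
    IntegrableOn (fun t : ℝ => t ^ (α - 1) * (1 - t) ^ (β - 1)) (Ioo 0 1) ∧
    ∫ t in Ioo (0:ℝ) 1, t ^ (α - 1) * (1 - t) ^ (β - 1) =
      Real.Gamma α * Real.Gamma β / Real.Gamma (α + β) := by
  have hc := Complex.betaIntegral_convergent (u := α) (v := β) (by simpa) (by simpa)
  rw [intervalIntegrable_iff_integrableOn_Ioo_of_le zero_le_one] at hc
  have hcongr : ∀ t ∈ Ioo (0:ℝ) 1, ((t : ℂ) ^ ((α : ℂ) - 1) * (1 - (t:ℂ)) ^ ((β : ℂ) - 1)) =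
      ((t ^ (α - 1) * (1 - t) ^ (β - 1) : ℝ) : ℂ) := by
    intro t ht
    rw [Complex.ofReal_mul, Complex.ofReal_cpow ht.1.le, Complex.ofReal_cpow (by linarith [ht.2])]
    push_cast
    rfl
  have hint : IntegrableOn (fun t : ℝ => t ^ (α - 1) * (1 - t) ^ (β - 1)) (Ioo 0 1) := by
    have h1 := (hc.congr_fun hcongr measurableSet_Ioo).re
    change Integrable _ _
    simpa using h1
  refine ⟨hint, ?_⟩
  have h2 := ProbabilityTheory.beta_eq_betaIntegralReal α β hα hβ
  rw [ProbabilityTheory.beta, Complex.betaIntegral, intervalIntegral.integral_of_le zero_le_one,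
    integral_Ioc_eq_integral_Ioo, setIntegral_congr_fun measurableSet_Ioo hcongr,
    integral_complex_ofReal, Complex.ofReal_re] at h2
  exact h2.symm

lemma poch_succ (a : ℝ) (n : ℕ) : poch a (n+1) = poch a n * (a + n) := by
  simp [poch, Finset.prod_range_succ]

lemma poch_pos {a : ℝ} (ha : 0 < a) (n : ℕ) : 0 < poch a n :=
  Finset.prod_pos fun i _ => by positivity

lemma poch_mono {a b : ℝ} (ha : 0 < a) (hab : a ≤ b) (n : ℕ) : poch a n ≤ poch b n :=
  Finset.prod_le_prod (fun i _ => by positivity) (fun i _ => by linarith)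

lemma Gamma_poch {a : ℝ} (ha : 0 < a) (n : ℕ) :
    Real.Gamma (a + n) = poch a n * Real.Gamma a := by
  induction n with
  | zero => simp [poch]
  | succ n ih =>
    rw [poch_succ, Nat.cast_succ, ← add_assoc, Real.Gamma_add_one (by positivity), ih]
    ring

lemma binom_hasSum (a : ℝ) {y : ℝ} (hy : |y| < 1) :
    HasSum (fun n : ℕ => poch a n / (n ! : ℝ) * y ^ n) ((1 - y) ^ (-a)) := by
  have h := (Real.one_div_one_sub_rpow_hasFPowerSeriesOnBall_zero a).hasSum (y := y)
    (by simpa [← enorm_eq_nnnorm, Real.enorm_eq_ofReal_abs] using hy)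
  rw [zero_add] at h
  rw [Real.rpow_neg (by linarith [abs_lt.1 hy]), ← one_div]
  refine Eq.mp (congrArg (fun f => HasSum f _) (funext fun n => ?_)) h
  have h1 : Ring.choose (a + n - 1) n = poch a n / (n ! : ℝ) := by
    rw [← Ring.multichoose_eq]
    have := Ring.factorial_nsmul_multichoose_eq_ascPochhammer a n
    rw [Polynomial.ascPochhammer_smeval_eq_eval] at this
    have hp : (ascPochhammer ℝ n).eval a = poch a n := by
      clear this h
      induction n with
      | zero => simp [poch]
      | succ n ih => rw [poch_succ, ascPochhammer_succ_eval, ih]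
    rw [hp] at this
    rw [← this, nsmul_eq_mul]
    field_simp
  simp [h1, mul_comm]

lemma euler {a b d x : ℝ} (ha : 0 < a) (hb : 0 < b) (hd : 0 < d) (hx : 0 < x) (hx1 : x < 1) :
    ∫ t in Ioo (0:ℝ) 1, t ^ (b - 1) * (1 - t) ^ (d - 1) * (1 - x * t) ^ (-a) =
    Real.Gamma b * Real.Gamma d / Real.Gamma (b + d) * twoFone a b (b + d) x := by
  set B := Real.Gamma b * Real.Gamma d / Real.Gamma (b + d)
  set F : ℕ → ℝ → ℝ := fun n t =>
    (poch a n / (n ! : ℝ) * x ^ n) * (t ^ (b + n - 1) * (1 - t) ^ (d - 1)) with hF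
  have hI : ∀ n, IntegrableOn (F n) (Ioo 0 1) := fun n =>
    (beta_aux (α := b + n) (β := d) (by positivity) hd).1.const_mul _
  have hB : 0 < B := by
    have := Real.Gamma_pos_of_pos hb
    have := Real.Gamma_pos_of_pos hd
    have := Real.Gamma_pos_of_pos (add_pos hb hd)
    positivity
  have hv : ∀ n, ∫ t in Ioo (0:ℝ) 1, F n t =
      B * (poch a n * poch b n / (poch (b+d) n * (n ! : ℝ)) * x ^ n) := by
    intro n
    simp only [hF]
    rw [integral_const_mul, (beta_aux (α := b + n) (β := d) (by positivity) hd).2,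
      Gamma_poch hb, show b + n + d = (b + d) + n by ring, Gamma_poch (add_pos hb hd)]
    have := (Real.Gamma_pos_of_pos (add_pos hb hd)).ne'
    have := (poch_pos (add_pos hb hd) n).ne'
    simp only [B]
    field_simp
  have hn : ∀ n, ∫ t in Ioo (0:ℝ) 1, ‖F n t‖ = ∫ t in Ioo (0:ℝ) 1, F n t := by
    intro n
    refine setIntegral_congr_fun measurableSet_Ioo fun t ht => ?_
    refine Real.norm_of_nonneg ?_
    have h0 := ht.1
    have h1 : 0 < 1 - t := by linarith [ht.2]
    have := poch_pos ha n
    simp only [hF]; positivity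
  have hs : Summable fun n => ∫ t in Ioo (0:ℝ) 1, ‖F n t‖ := by
    have h := ((binom_hasSum a (y := x) (by rw [abs_of_pos hx]; exact hx1)).summable).mul_left B
    refine h.of_nonneg_of_le (fun n => integral_nonneg fun t => norm_nonneg _) fun n => ?_
    rw [hn, hv]
    have h1 := poch_pos ha n
    have h2 := poch_pos hb n
    have h3 := poch_pos (add_pos hb hd) n
    have h4 : poch b n / poch (b+d) n ≤ 1 := by
      rw [div_le_one h3]; exact poch_mono hb (by linarith) n
    have : poch a n * poch b n / (poch (b+d) n * (n ! : ℝ)) * x ^ n =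
      (poch a n / (n ! : ℝ) * x ^ n) * (poch b n / poch (b+d) n) := by
      field_simp
    rw [this]
    refine mul_le_mul_of_nonneg_left ?_ hB.le
    exact mul_le_of_le_one_right (by positivity) h4
  have key := hasSum_integral_of_summable_integral_norm hI hs
  have e1 := key.tsum_eq
  simp only [hv] at e1
  rw [tsum_mul_left] at e1
  rw [twoFone, e1]
  refine setIntegral_congr_fun measurableSet_Ioo fun t ht => ?_
  have h0 := ht.1
  have h1 := ht.2
  have hy : |x * t| < 1 := by rw [abs_of_pos (by positivity)]; nlinarith
  have hh := (binom_hasSum a hy).mul_left (t ^ (b - 1) * (1 - t) ^ (d - 1))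
  refine hh.tsum_eq.symm.trans (tsum_congr fun n => ?_)
  simp only [hF]
  rw [show b + n - 1 = (b - 1) + n by ring, Real.rpow_add_natCast h0.ne', mul_pow]
  ring

noncomputable def vv (t : ℝ) : ℝ := 5400000 * (1 - t) * t ^ 2 / ((128 - 3 * t) * (8 - 3 * t) ^ 5)
noncomputable def gg (t : ℝ) : ℝ := 2048 - 1944 * t - 756 * t ^ 2 + 27 * t ^ 3
noncomputable def vd (t : ℝ) : ℝ := 5400000 * t * gg t / ((128 - 3 * t) ^ 2 * (8 - 3 * t) ^ 6)

lemma vv_deriv {t : ℝ} (ht : t ≤ 1) : HasDerivAt vv (vd t) t := by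
  have hP : (128 - 3 * t) ≠ 0 := by linarith
  have hQ : (8 - 3 * t) ≠ 0 := by linarith
  have hid := hasDerivAt_id' t
  have h := ((((hid.const_sub 1).const_mul (5400000:ℝ)).mul (hid.pow 2)).div
    (((hid.const_mul (3:ℝ)).const_sub 128).mul (((hid.const_mul (3:ℝ)).const_sub 8).pow 5))
    (mul_ne_zero hP (pow_ne_zero 5 hQ)))
  refine HasDerivAt.congr_deriv (f := vv) h ?_
  simp only [vd, gg, Pi.mul_apply, Pi.pow_apply]
  rw [div_eq_div_iff (pow_ne_zero 2 (mul_ne_zero hP (pow_ne_zero 5 hQ)))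
    (mul_ne_zero (pow_ne_zero 2 hP) (pow_ne_zero 6 hQ))]
  norm_num
  ring

lemma one_sub_vv {t : ℝ} (ht : t ≤ 1) :
    1 - vv t = gg t ^ 2 / ((128 - 3 * t) * (8 - 3 * t) ^ 5) := by
  have hP : (128 - 3 * t) ≠ 0 := by linarith
  have hQ : (8 - 3 * t) ≠ 0 := by linarith
  have hd := mul_ne_zero hP (pow_ne_zero 5 hQ)
  rw [vv, gg, eq_div_iff hd, sub_mul, div_mul_cancel₀ _ hd]
  ring

lemma gg_anti {s t : ℝ} (hs : 0 ≤ s) (hst : s < t) (ht : t ≤ 1) : gg t < gg s := by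
  have : gg s - gg t = (t - s) * (1944 + 756 * (t + s) - 27 * (t ^ 2 + t * s + s ^ 2)) := by
    simp only [gg]; ring
  have h2 : 0 < (t - s) * (1944 + 756 * (t + s) - 27 * (t ^ 2 + t * s + s ^ 2)) := by
    apply mul_pos (by linarith)
    nlinarith
  linarith

noncomputable def KK : ℝ := (5400000:ℝ) ^ (3/10:ℝ) * (128:ℝ) ^ (-(4/5):ℝ)

lemma KK_pos : 0 < KK := by unfold KK; positivity

lemma pointwise {t : ℝ} (h0 : 0 < t) (h1 : t < 1) (hg : gg t ≠ 0) :
    |vd t| * (vv t ^ ((3/10:ℝ) - 1) * (1 - vv t) ^ ((1/2:ℝ) - 1)) =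
    KK * (t ^ ((3/5:ℝ) - 1) * (1 - t) ^ ((3/10:ℝ) - 1) * (1 - 3/128 * t) ^ (-(4/5):ℝ)) := by
  rw [one_sub_vv h1.le, ← sq_abs]
  have hvd : |vd t| = 5400000 * t * |gg t| / ((128 - 3 * t) ^ 2 * (8 - 3 * t) ^ 6) := by
    have hp1 : 0 < 128 - 3 * t := by linarith
    have hp2 : 0 < 8 - 3 * t := by linarith
    have hp3 : 0 < (128 - 3 * t) ^ 2 * (8 - 3 * t) ^ 6 := by positivity
    rw [vd, abs_div, abs_mul, abs_of_pos (by positivity : 0 < 5400000 * t), abs_of_pos hp3]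
  rw [hvd, vv, KK, show 128 - 3 * t = 128 * (1 - 3/128 * t) by ring]
  have hg' : 0 < |gg t| := abs_pos.2 hg
  generalize |gg t| = g at *
  have hP : 0 < 1 - 3/128 * t := by linarith
  have hQ : 0 < 8 - 3 * t := by linarith
  have hR : 0 < 1 - t := by linarith
  generalize 1 - 3/128 * t = P at *
  generalize 8 - 3 * t = Q at *
  generalize 1 - t = R at *
  apply Real.log_injOn_pos (Set.mem_Ioi.2 (by positivity)) (Set.mem_Ioi.2 (by positivity))
  have e1 : (5400000 * R * t ^ 2 / (128 * P * Q ^ 5)) ≠ 0 := by positivity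
  rw [Real.log_mul (by positivity) (by positivity), Real.log_mul (by positivity) (by positivity),
    Real.log_rpow (by positivity), Real.log_rpow (by positivity),
    Real.log_div (by positivity) (by positivity), Real.log_div (by positivity) (by positivity),
    Real.log_div (by positivity) (by positivity),
    Real.log_mul (by positivity) (by positivity), Real.log_mul (by positivity) (by positivity),
    Real.log_mul (by positivity) (by positivity), Real.log_mul (by positivity) (by positivity),
    Real.log_mul (by positivity) (by positivity), Real.log_mul (by positivity) (by positivity),
    Real.log_mul (by positivity) (by positivity), Real.log_mul (by positivity) (by positivity),
    Real.log_mul (by positivity) (by positivity), Real.log_mul (by positivity) (by positivity),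
    Real.log_rpow (by positivity), Real.log_rpow (by positivity), Real.log_rpow (by positivity),
    Real.log_mul (by positivity) (by positivity),
    Real.log_rpow (by positivity), Real.log_rpow (by positivity)]
  simp only [Real.log_pow]
  rw [Real.log_mul (by positivity) (by positivity)]
  push_cast
  ring

lemma exists_root : ∃ r : ℝ, 0 < r ∧ r < 1 ∧ gg r = 0 := by
  have hc : ContinuousOn gg (Icc 0 1) := by unfold gg; fun_prop
  have h := intermediate_value_Ioo' zero_le_one hc
  obtain ⟨r, hr, hr0⟩ := h (show (0:ℝ) ∈ Ioo (gg 1) (gg 0) by constructor <;> norm_num [gg])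
  exact ⟨r, hr.1, hr.2, hr0⟩

lemma subst_piece {a b : ℝ} (ha : 0 ≤ a) (hb : b ≤ 1)
    (hg : ∀ t ∈ Ioo a b, gg t ≠ 0) (hinj : InjOn vv (Ioo a b))
    (him : vv '' Ioo a b = Ioo 0 1) :
    IntegrableOn (fun t : ℝ => t ^ ((3/5:ℝ) - 1) * (1 - t) ^ ((3/10:ℝ) - 1) *
        (1 - 3/128 * t) ^ (-(4/5):ℝ)) (Ioo a b) ∧
    KK * ∫ t in Ioo a b, t ^ ((3/5:ℝ) - 1) * (1 - t) ^ ((3/10:ℝ) - 1) *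
        (1 - 3/128 * t) ^ (-(4/5):ℝ) =
      Real.Gamma (3/10) * Real.Gamma (1/2) / Real.Gamma (3/10 + 1/2) := by
  have hd : ∀ x ∈ Ioo a b, HasDerivWithinAt vv (vd x) (Ioo a b) x := fun x hx =>
    (vv_deriv (by linarith [hx.2])).hasDerivWithinAt
  obtain ⟨hI, hv⟩ := beta_aux (α := 3/10) (β := 1/2) (by norm_num) (by norm_num)
  have hpt : ∀ t ∈ Ioo a b, |vd t| • (vv t ^ ((3/10:ℝ) - 1) * (1 - vv t) ^ ((1/2:ℝ) - 1)) =
    KK * (t ^ ((3/5:ℝ) - 1) * (1 - t) ^ ((3/10:ℝ) - 1) * (1 - 3/128 * t) ^ (-(4/5):ℝ)) :=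
    fun t ht => pointwise (by linarith [ht.1]) (by linarith [ht.2]) (hg t ht)
  constructor
  · rw [← him, integrableOn_image_iff_integrableOn_abs_deriv_smul measurableSet_Ioo hd hinj] at hI
    have h2 := (hI.congr_fun hpt measurableSet_Ioo).const_mul KK⁻¹
    refine IntegrableOn.congr_fun h2 (fun t _ => ?_) measurableSet_Ioo
    rw [inv_mul_cancel_left₀ KK_pos.ne']
  · rw [← him, integral_image_eq_integral_abs_deriv_smul measurableSet_Ioo hd hinj,
      setIntegral_congr_fun measurableSet_Ioo hpt, integral_const_mul] at hv
    exact hv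

lemma full_integral :
    KK * ∫ t in Ioo (0:ℝ) 1, t ^ ((3/5:ℝ) - 1) * (1 - t) ^ ((3/10:ℝ) - 1) *
        (1 - 3/128 * t) ^ (-(4/5):ℝ) =
      2 * (Real.Gamma (3/10) * Real.Gamma (1/2) / Real.Gamma (3/10 + 1/2)) := by
  obtain ⟨r, hr0, hr1, hr⟩ := exists_root
  have hv0 : vv 0 = 0 := by simp [vv]
  have hv1 : vv 1 = 0 := by simp [vv]
  have hvr : vv r = 1 := by
    have := one_sub_vv hr1.le
    rw [hr] at this
    simp at this
    linarith
  have hcont : ContinuousOn vv (Icc 0 1) := fun x hx =>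
    (vv_deriv hx.2).continuousAt.continuousWithinAt
  have hden : ∀ t : ℝ, t < 1 → 0 < (128 - 3 * t) ^ 2 * (8 - 3 * t) ^ 6 := by
    intro t ht
    have : 0 < 128 - 3 * t := by linarith
    have : 0 < 8 - 3 * t := by linarith
    positivity
  have hm1 : StrictMonoOn vv (Icc 0 r) := by
    refine strictMonoOn_of_deriv_pos (convex_Icc _ _)
      (hcont.mono (Icc_subset_Icc_right hr1.le)) fun t ht => ?_
    rw [interior_Icc] at ht
    rw [(vv_deriv (by linarith [ht.2])).deriv, vd]
    have := gg_anti ht.1.le ht.2 hr1.le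
    rw [hr] at this
    have h0 := ht.1
    exact div_pos (by positivity) (hden t (by linarith [ht.2]))
  have hm2 : StrictAntiOn vv (Icc r 1) := by
    refine strictAntiOn_of_deriv_neg (convex_Icc _ _)
      (hcont.mono (Icc_subset_Icc_left hr0.le)) fun t ht => ?_
    rw [interior_Icc] at ht
    rw [(vv_deriv ht.2.le).deriv, vd]
    have := gg_anti hr0.le ht.1 ht.2.le
    rw [hr] at this
    have h0 : 0 < t := by linarith [ht.1]
    exact div_neg_of_neg_of_pos (mul_neg_of_pos_of_neg (by positivity) this) (hden t ht.2)
  obtain ⟨i1, e1⟩ := subst_piece (a := 0) (b := r) le_rfl hr1.le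
    (fun t ht => by
      have := gg_anti ht.1.le ht.2 hr1.le
      rw [hr] at this; exact this.ne')
    (hm1.injOn.mono Ioo_subset_Icc_self)
    (by
      apply Subset.antisymm
      · rintro _ ⟨t, ht, rfl⟩
        constructor
        · rw [← hv0]
          exact hm1 (left_mem_Icc.2 hr0.le) (Ioo_subset_Icc_self ht) ht.1
        · rw [← hvr]
          exact hm1 (Ioo_subset_Icc_self ht) (right_mem_Icc.2 hr0.le) ht.2
      · have := intermediate_value_Ioo hr0.le (hcont.mono (Icc_subset_Icc_right hr1.le))
        rwa [hv0, hvr] at this)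
  obtain ⟨i2, e2⟩ := subst_piece (a := r) (b := 1) hr0.le le_rfl
    (fun t ht => by
      have := gg_anti hr0.le ht.1 ht.2.le
      rw [hr] at this; exact this.ne)
    (hm2.injOn.mono Ioo_subset_Icc_self)
    (by
      apply Subset.antisymm
      · rintro _ ⟨t, ht, rfl⟩
        constructor
        · rw [← hv1]
          exact hm2 (Ioo_subset_Icc_self ht) (right_mem_Icc.2 hr1.le) ht.2
        · rw [← hvr]
          exact hm2 (left_mem_Icc.2 hr1.le) (Ioo_subset_Icc_self ht) ht.1
      · have := intermediate_value_Ioo' hr1.le (hcont.mono (Icc_subset_Icc_left hr0.le))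
        rwa [hv1, hvr] at this)
  have i2' := (integrableOn_Ico_iff_integrableOn_Ioo (μ := volume)).2 i2
  rw [← Ioo_union_Ico_eq_Ioo hr0 hr1.le, setIntegral_union _ measurableSet_Ico i1 i2',
    integral_Ico_eq_integral_Ioo, mul_add, e1, e2]
  · ring
  · rw [Set.disjoint_left]
    intro t h1 h2
    exact absurd h1.2 (not_lt.2 h2.1)

lemma sin_val : Real.sin (Real.pi * (2/5)) = Real.sqrt 2 * Real.sqrt (5 + Real.sqrt 5) / 4 := by
  have h5 : Real.sqrt 5 ^ 2 = 5 := Real.sq_sqrt (by norm_num)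
  have hc : Real.cos (Real.pi * (2/5)) = (Real.sqrt 5 - 1) / 4 := by
    rw [show Real.pi * (2/5) = 2 * (Real.pi / 5) by ring, Real.cos_two_mul, Real.cos_pi_div_five]
    linear_combination (1/8) * h5
  have hs : 0 ≤ Real.sin (Real.pi * (2/5)) :=
    Real.sin_nonneg_of_nonneg_of_le_pi (by positivity) (by nlinarith [Real.pi_pos])
  have h2 : Real.sqrt 2 ^ 2 = 2 := Real.sq_sqrt (by norm_num)
  have h3 : Real.sqrt (5 + Real.sqrt 5) ^ 2 = 5 + Real.sqrt 5 := Real.sq_sqrt (by positivity)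
  rw [← sq_eq_sq₀ hs (by positivity), Real.sin_sq, hc, div_pow, div_pow, mul_pow, h2, h3]
  linear_combination (-1/16) * h5

lemma KK_val : (2:ℝ) * 2 ^ (1 / 5 : ℝ) / 4 = KK * (8 / 75 * (3:ℝ) ^ ((1:ℝ)/10) * Real.sqrt 5) := by
  rw [Real.sqrt_eq_rpow, KK, show (5400000:ℝ) = 2 ^ 6 * 3 ^ 3 * 5 ^ 5 by norm_num,
    show (128:ℝ) = 2 ^ 7 by norm_num, show (8/75:ℝ) = 2 ^ 3 / (3 * 5 ^ 2) by norm_num,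
    show (4:ℝ) = 2 ^ 2 by norm_num]
  apply Real.log_injOn_pos (Set.mem_Ioi.2 (by positivity)) (Set.mem_Ioi.2 (by positivity))
  rw [Real.log_div (by positivity) (by positivity), Real.log_mul (by positivity) (by positivity),
    Real.log_mul (by positivity) (by positivity), Real.log_mul (by positivity) (by positivity),
    Real.log_mul (by positivity) (by positivity), Real.log_mul (by positivity) (by positivity),
    Real.log_div (by positivity) (by positivity), Real.log_mul (by positivity) (by positivity),
    Real.log_rpow (by positivity), Real.log_rpow (by positivity), Real.log_rpow (by positivity),
    Real.log_rpow (by positivity), Real.log_rpow (by positivity),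
    Real.log_mul (by positivity) (by positivity), Real.log_mul (by positivity) (by positivity)]
  simp only [Real.log_pow]
  push_cast
  ring

theorem stmt3 : twoFone (3/5) (4/5) (9/10) (3/128) = (8/75) * Real.sqrt 2 * (3:ℝ) ^ ((1:ℝ)/10) * Real.sqrt 5 * Real.sqrt (5 + Real.sqrt 5) := by
  have hsw : twoFone (3/5) (4/5) (9/10) (3/128) = twoFone (4/5) (3/5) (9/10) (3/128) := by
    simp only [twoFone, mul_comm (poch (3/5) _)]
  have hE := euler (a := 4/5) (b := 3/5) (d := 3/10) (x := 3/128) (by norm_num) (by norm_num)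
    (by norm_num) (by norm_num) (by norm_num)
  have hf := full_integral
  rw [hE, show (3/5:ℝ) + 3/10 = 9/10 by norm_num, ← hsw, show (3/10:ℝ) + 1/2 = 4/5 by norm_num] at hf
  have hd := Real.Gamma_mul_Gamma_add_half (2/5)
  have hrf := Real.Gamma_mul_Gamma_one_sub (2/5)
  rw [sin_val] at hrf
  norm_num only at hd hrf hf
  rw [show (1/2:ℝ) = 1/2 by rfl, Real.Gamma_one_half_eq] at hf
  have hk := KK_val
  have p1 := Real.Gamma_pos_of_pos (show (0:ℝ) < 2/5 by norm_num)
  have p2 := Real.Gamma_pos_of_pos (show (0:ℝ) < 3/5 by norm_num)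
  have p3 := Real.Gamma_pos_of_pos (show (0:ℝ) < 4/5 by norm_num)
  have p4 := Real.Gamma_pos_of_pos (show (0:ℝ) < 9/10 by norm_num)
  have p5 := Real.Gamma_pos_of_pos (show (0:ℝ) < 3/10 by norm_num)
  have p6 : 0 < Real.sqrt 2 * Real.sqrt (5 + Real.sqrt 5) := by positivity
  have hpi : Real.sqrt Real.pi * Real.sqrt Real.pi = Real.pi := Real.mul_self_sqrt Real.pi_pos.le
  have hpp := Real.pi_pos
  have hK := KK_pos
  generalize twoFone (3/5) (4/5) (9/10) (3/128) = T at *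
  have hs : 0 < Real.sqrt Real.pi := Real.sqrt_pos.2 hpp
  rw [show (8/75) * Real.sqrt 2 * (3:ℝ) ^ ((1:ℝ)/10) * Real.sqrt 5 * Real.sqrt (5 + Real.sqrt 5) =
    (8 / 75 * (3:ℝ) ^ ((1:ℝ)/10) * Real.sqrt 5) * (Real.sqrt 2 * Real.sqrt (5 + Real.sqrt 5)) by ring]
  rw [← hpi] at hrf
  clear hE hsw hpi
  generalize Real.sqrt 2 * Real.sqrt (5 + Real.sqrt 5) = σ at *
  generalize 8 / 75 * (3:ℝ) ^ ((1:ℝ)/10) * Real.sqrt 5 = Z at *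
  generalize (2:ℝ) ^ (1 / 5 : ℝ) = w at *
  generalize Real.sqrt Real.pi = s at *
  generalize Real.Gamma (2/5) = A at *
  generalize Real.Gamma (3/5) = B at *
  generalize Real.Gamma (4/5) = C at *
  generalize Real.Gamma (9/10) = E at *
  generalize Real.Gamma (3/10) = H at *
  generalize KK = K at *
  have h1 : A * B * σ = 4 * s ^ 2 := by
    rw [hrf]; field_simp
  have h2 : K * B * T * C = 2 * s * E := by
    field_simp at hf
    linear_combination hf
  have h3 : (4 * s ^ 2 * C * K) * T = (4 * s ^ 2 * C * K) * (Z * σ) := by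
    linear_combination (-K * C * T) * h1 + (A * σ) * h2 + (2 * s * σ) * hd + (4 * s ^ 2 * C * σ) * hk
  exact mul_left_cancel₀ (by positivity) h3
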